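/- Left weakening for resolution: let d : 𝔄₁ ⊗ ⟨i;P;G⟩ ⊗ 𝔄₂ ⇝^{[id]} □ be a flat successful derivation. Then for each program P' of level ≤ i such that elab(P') ⊇ elab(P), there is a flat successful derivation 𝔄₁ ⊗ ⟨i;P';G⟩ ⊗ 𝔄₂ ⇝^{[id]} □. -/

import Mathlib

set_option maxHeartbeats 1000000

/-! ## Syntax of UCTT / HOHH -/

/-- Simple types of Church's theory: individuals, propositions, arrow types. -/
inductive Ty : Type
  | iota : Ty
  | o : Ty
  | arr : Ty → Ty → Ty
  deriving DecidableEq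

/-- Free (logic) variables: carry an identifier, a level and a type. -/
structure Vr : Type where
  name : ℕ
  lvl : ℕ
  ty : Ty
  deriving DecidableEq

/-- Constants: carry an identifier, a level and a type. -/
structure Cs : Type where
  name : ℕ
  lvl : ℕ
  ty : Ty
  deriving DecidableEq

/-- Simply typed λ-terms in (principal) normal form, with formulas (terms of
type `o`) represented by dedicated constructors for the logical constants
`⊤, ⊥, ∧, ∨, ⊃, Π (∀), Σ (∃)` in applied position.  Bound variables (`bvar`)
and free (logic) variables (`fvar`) are disjoint. -/
inductive Tm : Type
  | bvar : ℕ → Ty → Tm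
  | fvar : Vr → Tm
  | cst : Cs → Tm
  | app : Tm → Tm → Tm
  | lam : ℕ → Ty → Tm → Tm
  | top : Tm
  | bot : Tm
  | conj : Tm → Tm → Tm
  | disj : Tm → Tm → Tm
  | impl : Tm → Tm → Tm
  | all : ℕ → Ty → Tm → Tm
  | ex : ℕ → Ty → Tm → Tm
  deriving DecidableEq

namespace Tm

/-- Applying a map on free variables to a term.  Since bound and free
variables are disjoint, no capture can occur. -/
def subst (f : Vr → Tm) : Tm → Tm
  | bvar n a => bvar n a
  | fvar v => f v
  | cst c => cst c
  | app t u => app (subst f t) (subst f u)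
  | lam n a t => lam n a (subst f t)
  | top => top
  | bot => bot
  | conj t u => conj (subst f t) (subst f u)
  | disj t u => disj (subst f t) (subst f u)
  | impl t u => impl (subst f t) (subst f u)
  | all n a t => all n a (subst f t)
  | ex n a t => ex n a (subst f t)

/-- Instantiation `t[s/x]` of the bound variable `(x, a)` by the term `s`. -/
def inst (x : ℕ) (a : Ty) (s : Tm) : Tm → Tm
  | bvar n b => if n = x ∧ b = a then s else bvar n b
  | fvar v => fvar v
  | cst c => cst c
  | app t u => app (inst x a s t) (inst x a s u)
  | lam n b t => if n = x ∧ b = a then lam n b t else lam n b (inst x a s t)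
  | top => top
  | bot => bot
  | conj t u => conj (inst x a s t) (inst x a s u)
  | disj t u => disj (inst x a s t) (inst x a s u)
  | impl t u => impl (inst x a s t) (inst x a s u)
  | all n b t => if n = x ∧ b = a then all n b t else all n b (inst x a s t)
  | ex n b t => if n = x ∧ b = a then ex n b t else ex n b (inst x a s t)

/-- The level of a term: the maximum label of the constants and free
variables occurring in it. -/
def lvl : Tm → ℕ
  | bvar _ _ => 0
  | fvar v => v.lvl
  | cst c => c.lvl
  | app t u => max (lvl t) (lvl u)
  | lam _ _ t => lvl t
  | top => 0
  | bot => 0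
  | conj t u => max (lvl t) (lvl u)
  | disj t u => max (lvl t) (lvl u)
  | impl t u => max (lvl t) (lvl u)
  | all _ _ t => lvl t
  | ex _ _ t => lvl t

/-- The free variables of a term. -/
def fvars : Tm → Finset Vr
  | bvar _ _ => ∅
  | fvar v => {v}
  | cst _ => ∅
  | app t u => fvars t ∪ fvars u
  | lam _ _ t => fvars t
  | top => ∅
  | bot => ∅
  | conj t u => fvars t ∪ fvars u
  | disj t u => fvars t ∪ fvars u
  | impl t u => fvars t ∪ fvars u
  | all _ _ t => fvars t
  | ex _ _ t => fvars t

/-- The constants occurring in a term. -/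
def csts : Tm → Finset Cs
  | bvar _ _ => ∅
  | fvar _ => ∅
  | cst c => {c}
  | app t u => csts t ∪ csts u
  | lam _ _ t => csts t
  | top => ∅
  | bot => ∅
  | conj t u => csts t ∪ csts u
  | disj t u => csts t ∪ csts u
  | impl t u => csts t ∪ csts u
  | all _ _ t => csts t
  | ex _ _ t => csts t

/-- The canonical type of a term (meaningful on well-typed terms). -/
def tyOf : Tm → Ty
  | bvar _ a => a
  | fvar v => v.ty
  | cst c => c.ty
  | app t _ =>
      match tyOf t with
      | Ty.arr _ b => b
      | b => b
  | lam _ a t => Ty.arr a (tyOf t)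
  | _ => Ty.o

/-- Well-typedness of a term. -/
def wt : Tm → Prop
  | bvar _ _ => True
  | fvar _ => True
  | cst _ => True
  | app t u => wt t ∧ wt u ∧ ∃ b, tyOf t = Ty.arr (tyOf u) b
  | lam _ _ t => wt t
  | top => True
  | bot => True
  | conj t u => wt t ∧ wt u ∧ tyOf t = Ty.o ∧ tyOf u = Ty.o
  | disj t u => wt t ∧ wt u ∧ tyOf t = Ty.o ∧ tyOf u = Ty.o
  | impl t u => wt t ∧ wt u ∧ tyOf t = Ty.o ∧ tyOf u = Ty.o
  | all _ _ t => wt t ∧ tyOf t = Ty.o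
  | ex _ _ t => wt t ∧ tyOf t = Ty.o

/-- Positive terms: terms not containing `⊥`, `⊃` or `∀`. -/
def pos : Tm → Prop
  | bot => False
  | impl _ _ => False
  | all _ _ _ => False
  | app t u => pos t ∧ pos u
  | lam _ _ t => pos t
  | conj t u => pos t ∧ pos u
  | disj t u => pos t ∧ pos u
  | ex _ _ t => pos t
  | _ => True

/-- The head of an application spine. -/
def headTm : Tm → Tm
  | app t _ => headTm t
  | t => t

/-- Atomic formulas: terms (of type `o`) whose outermost constructor is not
a logical constant. -/
def isAtom : Tm → Prop
  | fvar _ => True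
  | cst _ => True
  | app _ _ => True
  | _ => False

/-- An atomic formula is rigid when its head symbol is a constant. -/
def rigid (t : Tm) : Prop := ∃ c : Cs, t.headTm = cst c

mutual
  /-- HOHH program formulas: `D ::= A_r | G ⊃ A_r | D ∧ D | ∀x.D`. -/
  inductive isProg : Tm → Prop
    | atom {t : Tm} : t.isAtom → t.rigid → isProg t
    | imp {g a : Tm} : isGoal g → a.isAtom → a.rigid → isProg (Tm.impl g a)
    | conj {d₁ d₂ : Tm} : isProg d₁ → isProg d₂ → isProg (Tm.conj d₁ d₂)
    | all {n : ℕ} {a : Ty} {d : Tm} : isProg d → isProg (Tm.all n a d)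

  /-- HOHH goal formulas:
  `G ::= ⊤ | A | G ∨ G | G ∧ G | ∃x.G | D ⊃ G | ∀x.G`. -/
  inductive isGoal : Tm → Prop
    | top : isGoal Tm.top
    | atom {t : Tm} : t.isAtom → isGoal t
    | conj {g₁ g₂ : Tm} : isGoal g₁ → isGoal g₂ → isGoal (Tm.conj g₁ g₂)
    | disj {g₁ g₂ : Tm} : isGoal g₁ → isGoal g₂ → isGoal (Tm.disj g₁ g₂)
    | ex {n : ℕ} {a : Ty} {g : Tm} : isGoal g → isGoal (Tm.ex n a g)
    | imp {d g : Tm} : isProg d → isGoal g → isGoal (Tm.impl d g)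
    | all {n : ℕ} {a : Ty} {g : Tm} : isGoal g → isGoal (Tm.all n a g)
end

/-- The elaboration of a program formula into its set of clauses. -/
def elabD : Tm → Set Tm
  | Tm.conj d₁ d₂ => elabD d₁ ∪ elabD d₂
  | Tm.all n a d => Tm.all n a '' elabD d
  | d => {d}

/-- Iterated universal quantification `∀x₁ … ∀xₙ. t`. -/
def alls : List (ℕ × Ty) → Tm → Tm
  | [], t => t
  | x :: xs, t => Tm.all x.1 x.2 (alls xs t)

/-- Simultaneous instantiation of a list of bound variables by a list of
terms (outermost binder first). -/
def instL : List (ℕ × Ty) → List Tm → Tm → Tm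
  | x :: xs, s :: ss, t => instL xs ss (inst x.1 x.2 s t)
  | _, _, t => t

end Tm

/-- The elaboration of a program (set of program formulas). -/
def elabProg (P : Finset Tm) : Set Tm := ⋃ D ∈ P, Tm.elabD D

/-! ## Substitutions -/

/-- Substitutions: finitely supported maps from free variables to terms. -/
structure Subst : Type where
  f : Vr → Tm
  fin : Set.Finite {v : Vr | f v ≠ Tm.fvar v}

namespace Subst

/-- The domain (support) of a substitution. -/
def dom (θ : Subst) : Set Vr := {v : Vr | θ.f v ≠ Tm.fvar v}

/-- The identity substitution. -/
protected def id : Subst :=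
  ⟨fun v => Tm.fvar v, by
    have : {v : Vr | Tm.fvar v ≠ Tm.fvar v} = ∅ := by ext v; simp
    rw [this]; exact Set.finite_empty⟩

/-- Composition of substitutions, in diagrammatic order. -/
def comp (σ τ : Subst) : Subst :=
  ⟨fun v => (σ.f v).subst τ.f, by
    apply Set.Finite.subset (σ.fin.union τ.fin)
    intro v hv
    simp only [Set.mem_setOf_eq] at hv
    by_contra h
    simp only [Set.mem_union, Set.mem_setOf_eq, not_or, not_not] at h
    apply hv
    rw [h.1]
    simp [Tm.subst, h.2]⟩

/-- Restriction of a substitution to a finite set of variables. -/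
def restrict (σ : Subst) (S : Finset Vr) : Subst :=
  ⟨fun v => if v ∈ S then σ.f v else Tm.fvar v, by
    apply Set.Finite.subset σ.fin
    intro v hv
    simp only [Set.mem_setOf_eq] at hv ⊢
    by_cases h : v ∈ S
    · simpa [h] using hv
    · simp [h] at hv⟩

/-- The substitution replacing the single variable `x` by the term `t`. -/
def single (x : Vr) (t : Tm) : Subst :=
  ⟨fun v => if v = x then t else Tm.fvar v, by
    apply Set.Finite.subset (Set.finite_singleton x)
    intro v hv
    simp only [Set.mem_setOf_eq] at hv
    by_cases h : v = x
    · simp [h]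
    · simp [h] at hv⟩

/-- Legal substitutions: the range consists of positive well-typed terms,
types are preserved, and levels are preserved. -/
def legal (θ : Subst) : Prop :=
  ∀ v : Vr, (θ.f v).pos ∧ (θ.f v).wt ∧ (θ.f v).tyOf = v.ty ∧ (θ.f v).lvl ≤ v.lvl

/-- Safe (idempotent) substitutions: the free variables of the range are
disjoint from the domain. -/
def safe (θ : Subst) : Prop :=
  ∀ v w : Vr, θ.f v ≠ Tm.fvar v → w ∈ (θ.f v).fvars → θ.f w = Tm.fvar w

/-- A substitution has level `≤ i` when every term in its range does. -/
def lvlLe (θ : Subst) (i : ℕ) : Prop :=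
  ∀ v ∈ θ.dom, (θ.f v).lvl ≤ i

end Subst

/-! ## States, state vectors and the resolution proof procedure RES(t) -/

/-- A state `⟨i; P; G⟩`: an index, a program and a goal. -/
structure St : Type where
  idx : ℕ
  prog : Finset Tm
  goal : Tm
  deriving DecidableEq

namespace St

/-- Applying a substitution to a state. -/
def sub (θ : Subst) (s : St) : St :=
  ⟨s.idx, s.prog.image (Tm.subst θ.f), Tm.subst θ.f s.goal⟩

/-- Free variables of a state. -/
def fvars (s : St) : Finset Vr := s.prog.sup Tm.fvars ∪ s.goal.fvars

/-- Constants of a state. -/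
def csts (s : St) : Finset Cs := s.prog.sup Tm.csts ∪ s.goal.csts

/-- Well-formedness of a state: the program consists of well-typed program
formulas of level at most the index, and the goal is a well-typed goal
formula of level at most the index. -/
def wf (s : St) : Prop :=
  (∀ D ∈ s.prog, Tm.isProg D ∧ D.wt ∧ D.tyOf = Ty.o ∧ D.lvl ≤ s.idx) ∧
    Tm.isGoal s.goal ∧ s.goal.wt ∧ s.goal.tyOf = Ty.o ∧ s.goal.lvl ≤ s.idx

end St

/-- Applying a substitution to a state vector. -/
def svSub (θ : Subst) (A : List St) : List St := A.map (St.sub θ)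

/-- Free variables of a state vector. -/
def svFvars (A : List St) : Finset Vr := A.foldr (fun s acc => s.fvars ∪ acc) ∅

/-- Constants of a state vector. -/
def svCsts (A : List St) : Finset Cs := A.foldr (fun s acc => s.csts ∪ acc) ∅

/-- Well-formedness of a state vector. -/
def svWf (A : List St) : Prop := ∀ s ∈ A, s.wf

/-- One resolution step of the RES(t) transition system, acting on a selected
state of the state vector.  The rules are: null, true, backchain, axiom,
or, and, instance, augment and generic. -/
inductive Step : List St → Subst → List St → Prop
  | null (A B : List St) (i : ℕ) (P : Finset Tm) :
      Step (A ++ St.mk i P Tm.top :: B) Subst.id (A ++ B)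
  | tru (A B : List St) (i : ℕ) (P : Finset Tm) (g : Tm) (θ : Subst) :
      g.isAtom → θ.legal → θ ≠ Subst.id → Tm.subst θ.f g = Tm.top →
      Step (A ++ St.mk i P g :: B) θ
        (svSub θ A ++ St.mk i (P.image (Tm.subst θ.f)) Tm.top :: svSub θ B)
  | backchain (A B : List St) (i : ℕ) (P : Finset Tm) (g : Tm)
      (xs : List (ℕ × Ty)) (G Ar : Tm) (ws : List Vr) (θ : Subst) :
      g.isAtom → g.rigid →
      Tm.alls xs (Tm.impl G Ar) ∈ elabProg P →
      List.Forall₂ (fun (w : Vr) (x : ℕ × Ty) => w.ty = x.2 ∧ w.lvl ≤ i) ws xs →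
      ws.Nodup →
      (∀ w ∈ ws, w ∉ svFvars (A ++ St.mk i P g :: B)) →
      θ.legal →
      Tm.subst θ.f g = Tm.subst θ.f (Tm.instL xs (ws.map Tm.fvar) Ar) →
      Step (A ++ St.mk i P g :: B) θ
        (svSub θ A ++
          St.mk i (P.image (Tm.subst θ.f))
            (Tm.subst θ.f (Tm.instL xs (ws.map Tm.fvar) G)) :: svSub θ B)
  | ax (A B : List St) (i : ℕ) (P : Finset Tm) (g : Tm)
      (xs : List (ℕ × Ty)) (Ar : Tm) (ws : List Vr) (θ : Subst) :
      g.isAtom → g.rigid →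
      Ar.isAtom →
      Tm.alls xs Ar ∈ elabProg P →
      List.Forall₂ (fun (w : Vr) (x : ℕ × Ty) => w.ty = x.2 ∧ w.lvl ≤ i) ws xs →
      ws.Nodup →
      (∀ w ∈ ws, w ∉ svFvars (A ++ St.mk i P g :: B)) →
      θ.legal →
      Tm.subst θ.f g = Tm.subst θ.f (Tm.instL xs (ws.map Tm.fvar) Ar) →
      Step (A ++ St.mk i P g :: B) θ (svSub θ A ++ svSub θ B)
  | orl (A B : List St) (i : ℕ) (P : Finset Tm) (g₁ g₂ : Tm) :
      Step (A ++ St.mk i P (Tm.disj g₁ g₂) :: B) Subst.id (A ++ St.mk i P g₁ :: B)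
  | orr (A B : List St) (i : ℕ) (P : Finset Tm) (g₁ g₂ : Tm) :
      Step (A ++ St.mk i P (Tm.disj g₁ g₂) :: B) Subst.id (A ++ St.mk i P g₂ :: B)
  | and (A B : List St) (i : ℕ) (P : Finset Tm) (g₁ g₂ : Tm) :
      Step (A ++ St.mk i P (Tm.conj g₁ g₂) :: B) Subst.id
        (A ++ St.mk i P g₁ :: St.mk i P g₂ :: B)
  | inst (A B : List St) (i : ℕ) (P : Finset Tm) (x : ℕ) (a : Ty) (g t : Tm) :
      t.pos → t.wt → t.tyOf = a → t.lvl ≤ i →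
      Step (A ++ St.mk i P (Tm.ex x a g) :: B) Subst.id
        (A ++ St.mk i P (Tm.inst x a t g) :: B)
  | augment (A B : List St) (i : ℕ) (P : Finset Tm) (d g : Tm) :
      Step (A ++ St.mk i P (Tm.impl d g) :: B) Subst.id
        (A ++ St.mk i (insert d P) g :: B)
  | generic (A B : List St) (i : ℕ) (P : Finset Tm) (x : ℕ) (a : Ty) (g : Tm)
      (c : Cs) :
      c.lvl = i + 1 → c.ty = a → c ∉ svCsts (A ++ St.mk i P (Tm.all x a g) :: B) →
      Step (A ++ St.mk i P (Tm.all x a g) :: B) Subst.id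
        (A ++ St.mk (i + 1) P (Tm.inst x a (Tm.cst c) g) :: B)

/-- One *flat* resolution step: as `Step`, but the true rule is forbidden and
in the backchain and axiom rules the substitution must be safe with domain
contained in the fresh renaming variables. -/
inductive FlatStep : List St → Subst → List St → Prop
  | null (A B : List St) (i : ℕ) (P : Finset Tm) :
      FlatStep (A ++ St.mk i P Tm.top :: B) Subst.id (A ++ B)
  | backchain (A B : List St) (i : ℕ) (P : Finset Tm) (g : Tm)
      (xs : List (ℕ × Ty)) (G Ar : Tm) (ws : List Vr) (θ : Subst) :
      g.isAtom → g.rigid →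
      Tm.alls xs (Tm.impl G Ar) ∈ elabProg P →
      List.Forall₂ (fun (w : Vr) (x : ℕ × Ty) => w.ty = x.2 ∧ w.lvl ≤ i) ws xs →
      ws.Nodup →
      (∀ w ∈ ws, w ∉ svFvars (A ++ St.mk i P g :: B)) →
      θ.legal → θ.safe → (∀ v : Vr, θ.f v ≠ Tm.fvar v → v ∈ ws) →
      Tm.subst θ.f g = Tm.subst θ.f (Tm.instL xs (ws.map Tm.fvar) Ar) →
      FlatStep (A ++ St.mk i P g :: B) θ
        (svSub θ A ++
          St.mk i (P.image (Tm.subst θ.f))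
            (Tm.subst θ.f (Tm.instL xs (ws.map Tm.fvar) G)) :: svSub θ B)
  | ax (A B : List St) (i : ℕ) (P : Finset Tm) (g : Tm)
      (xs : List (ℕ × Ty)) (Ar : Tm) (ws : List Vr) (θ : Subst) :
      g.isAtom → g.rigid →
      Ar.isAtom →
      Tm.alls xs Ar ∈ elabProg P →
      List.Forall₂ (fun (w : Vr) (x : ℕ × Ty) => w.ty = x.2 ∧ w.lvl ≤ i) ws xs →
      ws.Nodup →
      (∀ w ∈ ws, w ∉ svFvars (A ++ St.mk i P g :: B)) →
      θ.legal → θ.safe → (∀ v : Vr, θ.f v ≠ Tm.fvar v → v ∈ ws) →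
      Tm.subst θ.f g = Tm.subst θ.f (Tm.instL xs (ws.map Tm.fvar) Ar) →
      FlatStep (A ++ St.mk i P g :: B) θ (svSub θ A ++ svSub θ B)
  | orl (A B : List St) (i : ℕ) (P : Finset Tm) (g₁ g₂ : Tm) :
      FlatStep (A ++ St.mk i P (Tm.disj g₁ g₂) :: B) Subst.id (A ++ St.mk i P g₁ :: B)
  | orr (A B : List St) (i : ℕ) (P : Finset Tm) (g₁ g₂ : Tm) :
      FlatStep (A ++ St.mk i P (Tm.disj g₁ g₂) :: B) Subst.id (A ++ St.mk i P g₂ :: B)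
  | and (A B : List St) (i : ℕ) (P : Finset Tm) (g₁ g₂ : Tm) :
      FlatStep (A ++ St.mk i P (Tm.conj g₁ g₂) :: B) Subst.id
        (A ++ St.mk i P g₁ :: St.mk i P g₂ :: B)
  | inst (A B : List St) (i : ℕ) (P : Finset Tm) (x : ℕ) (a : Ty) (g t : Tm) :
      t.pos → t.wt → t.tyOf = a → t.lvl ≤ i →
      FlatStep (A ++ St.mk i P (Tm.ex x a g) :: B) Subst.id
        (A ++ St.mk i P (Tm.inst x a t g) :: B)
  | augment (A B : List St) (i : ℕ) (P : Finset Tm) (d g : Tm) :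
      FlatStep (A ++ St.mk i P (Tm.impl d g) :: B) Subst.id
        (A ++ St.mk i (insert d P) g :: B)
  | generic (A B : List St) (i : ℕ) (P : Finset Tm) (x : ℕ) (a : Ty) (g : Tm)
      (c : Cs) :
      c.lvl = i + 1 → c.ty = a → c ∉ svCsts (A ++ St.mk i P (Tm.all x a g) :: B) →
      FlatStep (A ++ St.mk i P (Tm.all x a g) :: B) Subst.id
        (A ++ St.mk (i + 1) P (Tm.inst x a (Tm.cst c) g) :: B)

/-- A resolution derivation of the indicated length, carrying the (full,
unrestricted) composition of the intervening substitutions. -/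
inductive Deriv : List St → Subst → List St → ℕ → Prop
  | refl (A : List St) : Deriv A Subst.id A 0
  | step {A B C : List St} {σ τ : Subst} {n : ℕ} :
      Step A σ B → Deriv B τ C n → Deriv A (σ.comp τ) C (n + 1)

/-- A flat derivation `𝔄 ⇝^{[id]} 𝔅` of the indicated length. -/
inductive FlatDeriv : List St → List St → ℕ → Prop
  | refl (A : List St) : FlatDeriv A A 0
  | step {A B C : List St} {σ : Subst} {n : ℕ} :
      FlatStep A σ B → FlatDeriv B C n → FlatDeriv A C (n + 1)

/-- `Resolves A θ C`: there is a resolution derivation from `A` to `C` whose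
computed answer (the composition of the intervening substitutions restricted
to the variables free in `A`) is `θ`. -/
def Resolves (A : List St) (θ : Subst) (C : List St) : Prop :=
  ∃ (n : ℕ) (σ : Subst), Deriv A σ C n ∧ θ = σ.restrict (svFvars A)
/-- A renaming: permutations of the free variables and of the constants that
preserve levels and types. -/
structure Renaming : Type where
  v : Equiv.Perm Vr
  c : Equiv.Perm Cs
  v_lvl : ∀ x, (v x).lvl = x.lvl
  v_ty : ∀ x, (v x).ty = x.ty
  c_lvl : ∀ x, (c x).lvl = x.lvl
  c_ty : ∀ x, (c x).ty = x.ty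

namespace Tm

/-- Renaming the free variables and constants of a term. -/
def ren (r : Renaming) : Tm → Tm
  | bvar n a => bvar n a
  | fvar v => fvar (r.v v)
  | cst c => cst (r.c c)
  | app t u => app (ren r t) (ren r u)
  | lam n a t => lam n a (ren r t)
  | top => top
  | bot => bot
  | conj t u => conj (ren r t) (ren r u)
  | disj t u => disj (ren r t) (ren r u)
  | impl t u => impl (ren r t) (ren r u)
  | all n a t => all n a (ren r t)
  | ex n a t => ex n a (ren r t)

variable (r : Renaming)

theorem lvl_ren (t : Tm) : (t.ren r).lvl = t.lvl := by
  induction t <;> simp_all [ren, lvl, r.v_lvl, r.c_lvl]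

theorem tyOf_ren (t : Tm) : (t.ren r).tyOf = t.tyOf := by
  induction t <;> simp_all [ren, tyOf, r.v_ty, r.c_ty]

theorem wt_ren (t : Tm) : (t.ren r).wt ↔ t.wt := by
  induction t <;> simp_all [ren, wt, tyOf_ren]

theorem pos_ren (t : Tm) : (t.ren r).pos ↔ t.pos := by
  induction t <;> simp_all [ren, pos]

theorem isAtom_ren (t : Tm) : (t.ren r).isAtom ↔ t.isAtom := by
  cases t <;> simp [ren, isAtom]

theorem headTm_ren (t : Tm) : (t.ren r).headTm = t.headTm.ren r := by
  induction t <;> simp_all [ren, headTm]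

theorem rigid.ren {t : Tm} (h : t.rigid) : (t.ren r).rigid := by
  obtain ⟨c, hc⟩ := h
  exact ⟨r.c c, by rw [headTm_ren, hc, Tm.ren]⟩

theorem fvars_ren (t : Tm) : (t.ren r).fvars = t.fvars.image r.v := by
  induction t <;> simp_all [Tm.ren, fvars, Finset.image_union]

theorem csts_ren (t : Tm) : (t.ren r).csts = t.csts.image r.c := by
  induction t <;> simp_all [Tm.ren, csts, Finset.image_union]

theorem inst_ren (x : ℕ) (a : Ty) (s t : Tm) :
    (inst x a s t).ren r = inst x a (s.ren r) (t.ren r) := by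
  induction t <;> simp only [Tm.ren, inst] <;> (try split_ifs) <;> simp_all [Tm.ren]

theorem instL_ren (xs : List (ℕ × Ty)) (ss : List Tm) (t : Tm) :
    (instL xs ss t).ren r = instL xs (ss.map (Tm.ren r)) (t.ren r) := by
  induction xs generalizing ss t with
  | nil => simp [instL]
  | cons x xs ih => cases ss <;> simp [instL, ih, inst_ren]

theorem alls_ren (xs : List (ℕ × Ty)) (t : Tm) :
    (alls xs t).ren r = alls xs (t.ren r) := by
  induction xs <;> simp_all [alls, Tm.ren]

theorem ren_mem_elabD {t d : Tm} (h : t ∈ d.elabD) : t.ren r ∈ (d.ren r).elabD := by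
  induction d generalizing t with
  | conj d e ihd ihe => exact h.imp ihd ihe
  | all n a d ih =>
    obtain ⟨u, hu, rfl⟩ := h
    exact ⟨u.ren r, ih hu, rfl⟩
  | _ =>
    simp only [elabD, Set.mem_singleton_iff] at h
    subst h
    simp [elabD, Tm.ren]

theorem ren_eq_self {t : Tm} (hv : ∀ v ∈ t.fvars, r.v v = v) (hc : ∀ c ∈ t.csts, r.c c = c) :
    t.ren r = t := by
  induction t <;> simp_all [Tm.ren, fvars, csts]

theorem subst_eq_self {f : Vr → Tm} {t : Tm} (h : ∀ v ∈ t.fvars, f v = fvar v) :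
    t.subst f = t := by
  induction t <;> simp_all [Tm.subst, fvars]

end Tm

theorem ren_mem_elabProg (r : Renaming) {t : Tm} {P : Finset Tm} (h : t ∈ elabProg P) :
    t.ren r ∈ elabProg (P.image (Tm.ren r)) := by
  simp only [elabProg, Set.mem_iUnion] at h ⊢
  obtain ⟨d, hd, ht⟩ := h
  exact ⟨d.ren r, Finset.mem_image_of_mem _ hd, Tm.ren_mem_elabD r ht⟩

namespace Subst

/-- The conjugate of a substitution by a renaming. -/
def ren (r : Renaming) (θ : Subst) : Subst :=
  ⟨fun v => (θ.f (r.v.symm v)).ren r, by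
    refine (θ.fin.image r.v).subset fun v hv => ⟨r.v.symm v, fun h => hv ?_, by simp⟩
    simp [h, Tm.ren]⟩

theorem subst_ren (r : Renaming) (θ : Subst) (t : Tm) :
    (t.ren r).subst (θ.ren r).f = (t.subst θ.f).ren r := by
  induction t <;> simp_all [Tm.ren, Tm.subst, Subst.ren]

theorem ren_f_ne {r : Renaming} {θ : Subst} {v : Vr} (h : (θ.ren r).f v ≠ Tm.fvar v) :
    θ.f (r.v.symm v) ≠ Tm.fvar (r.v.symm v) := by
  intro h'
  exact h (by simp [Subst.ren, h', Tm.ren])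

theorem legal.ren {θ : Subst} (r : Renaming) (h : θ.legal) : (θ.ren r).legal := by
  intro v
  obtain ⟨h₁, h₂, h₃, h₄⟩ := h (r.v.symm v)
  refine ⟨(Tm.pos_ren r _).2 h₁, (Tm.wt_ren r _).2 h₂, ?_, ?_⟩
  · simpa [Subst.ren, Tm.tyOf_ren, h₃] using (r.v_ty (r.v.symm v)).symm
  · have := r.v_lvl (r.v.symm v)
    rw [Equiv.apply_symm_apply] at this
    simpa [Subst.ren, Tm.lvl_ren, this] using h₄

theorem safe.ren {θ : Subst} (r : Renaming) (h : θ.safe) : (θ.ren r).safe := by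
  intro v w hv hw
  simp only [Subst.ren, Tm.fvars_ren, Finset.mem_image] at hw
  obtain ⟨u, hu, rfl⟩ := hw
  simp [Subst.ren, h _ u (ren_f_ne hv) hu, Tm.ren]

end Subst

namespace St

/-- Renaming a state. -/
def ren (r : Renaming) (s : St) : St :=
  ⟨s.idx, s.prog.image (Tm.ren r), s.goal.ren r⟩

theorem mem_fvars {s : St} {v : Vr} :
    v ∈ s.fvars ↔ (∃ D ∈ s.prog, v ∈ D.fvars) ∨ v ∈ s.goal.fvars := by
  simp [fvars, Finset.mem_sup]

theorem mem_csts {s : St} {c : Cs} :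
    c ∈ s.csts ↔ (∃ D ∈ s.prog, c ∈ D.csts) ∨ c ∈ s.goal.csts := by
  simp [csts, Finset.mem_sup]

theorem fvars_ren (r : Renaming) (s : St) : (s.ren r).fvars = s.fvars.image r.v := by
  ext v
  simp only [mem_fvars, ren, Finset.mem_image, exists_exists_and_eq_and, Tm.fvars_ren]
  aesop

theorem csts_ren (r : Renaming) (s : St) : (s.ren r).csts = s.csts.image r.c := by
  ext c
  simp only [mem_csts, ren, Finset.mem_image, exists_exists_and_eq_and, Tm.csts_ren]
  aesop

theorem ren_eq_self {r : Renaming} {s : St} (hv : ∀ v ∈ s.fvars, r.v v = v)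
    (hc : ∀ c ∈ s.csts, r.c c = c) : s.ren r = s := by
  obtain ⟨i, P, g⟩ := s
  have hg : g.ren r = g := Tm.ren_eq_self r
    (fun v h => hv v (mem_fvars.2 (.inr h))) (fun c h => hc c (mem_csts.2 (.inr h)))
  have hP : P.image (Tm.ren r) = P := by
    refine (Finset.image_congr (g := id) fun D hD => ?_).trans Finset.image_id
    exact Tm.ren_eq_self r (fun v h => hv v (mem_fvars.2 (.inl ⟨D, hD, h⟩)))
      (fun c h => hc c (mem_csts.2 (.inl ⟨D, hD, h⟩)))
  simp [ren, hg, hP]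

theorem image_subst_eq_self {θ : Subst} {s : St} (h : ∀ v ∈ s.fvars, θ.f v = Tm.fvar v) :
    s.prog.image (Tm.subst θ.f) = s.prog := by
  refine (Finset.image_congr (g := id) fun D hD => ?_).trans Finset.image_id
  exact Tm.subst_eq_self fun v hv => h v (mem_fvars.2 (.inl ⟨D, hD, hv⟩))

theorem sub_eq_self {θ : Subst} {s : St} (h : ∀ v ∈ s.fvars, θ.f v = Tm.fvar v) :
    s.sub θ = s := by
  have hg : s.goal.subst θ.f = s.goal :=
    Tm.subst_eq_self fun v hv => h v (mem_fvars.2 (.inr hv))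
  simp [sub, hg, image_subst_eq_self h]

/-- `s.Weaker s'`: the states agree up to their programs, and every clause of
the program of `s` is a clause of the program of `s'`. -/
def Weaker (s s' : St) : Prop :=
  s.idx = s'.idx ∧ elabProg s.prog ⊆ elabProg s'.prog ∧ s.goal = s'.goal

theorem Weaker.refl (s : St) : s.Weaker s := ⟨rfl, subset_rfl, rfl⟩

end St

theorem mem_svFvars {A : List St} {v : Vr} : v ∈ svFvars A ↔ ∃ s ∈ A, v ∈ s.fvars := by
  induction A <;> simp_all [svFvars]

theorem mem_svCsts {A : List St} {c : Cs} : c ∈ svCsts A ↔ ∃ s ∈ A, c ∈ s.csts := by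
  induction A <;> simp_all [svCsts]

theorem svFvars_map_ren (r : Renaming) (A : List St) :
    svFvars (A.map (St.ren r)) = (svFvars A).image r.v := by
  ext v
  simp only [mem_svFvars, List.mem_map, Finset.mem_image]
  constructor
  · rintro ⟨_, ⟨s, hs, rfl⟩, hv⟩
    rw [St.fvars_ren, Finset.mem_image] at hv
    obtain ⟨w, hw, rfl⟩ := hv
    exact ⟨w, ⟨s, hs, hw⟩, rfl⟩
  · rintro ⟨w, ⟨s, hs, hw⟩, rfl⟩
    exact ⟨_, ⟨s, hs, rfl⟩, by rw [St.fvars_ren]; exact Finset.mem_image_of_mem _ hw⟩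

theorem svCsts_map_ren (r : Renaming) (A : List St) :
    svCsts (A.map (St.ren r)) = (svCsts A).image r.c := by
  ext v
  simp only [mem_svCsts, List.mem_map, Finset.mem_image]
  constructor
  · rintro ⟨_, ⟨s, hs, rfl⟩, hv⟩
    rw [St.csts_ren, Finset.mem_image] at hv
    obtain ⟨w, hw, rfl⟩ := hv
    exact ⟨w, ⟨s, hs, hw⟩, rfl⟩
  · rintro ⟨w, ⟨s, hs, hw⟩, rfl⟩
    exact ⟨_, ⟨s, hs, rfl⟩, by rw [St.csts_ren]; exact Finset.mem_image_of_mem _ hw⟩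

theorem map_ren_eq_self {r : Renaming} {A : List St} (hv : ∀ v ∈ svFvars A, r.v v = v)
    (hc : ∀ c ∈ svCsts A, r.c c = c) : A.map (St.ren r) = A :=
  (List.map_congr_left (g := id) fun s hs =>
    St.ren_eq_self (fun v h => hv v (mem_svFvars.2 ⟨s, hs, h⟩))
      fun c h => hc c (mem_svCsts.2 ⟨s, hs, h⟩)).trans (List.map_id A)

theorem svSub_eq_self {θ : Subst} {A : List St} (h : ∀ v ∈ svFvars A, θ.f v = Tm.fvar v) :
    svSub θ A = A :=
  (List.map_congr_left (g := id) fun s hs =>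
    St.sub_eq_self fun v hv => h v (mem_svFvars.2 ⟨s, hs, hv⟩)).trans (List.map_id A)

/-- The effect of a flat resolution step on the selected state.  The indices
`W` and `K` record the fresh variables and constants it introduces. -/
inductive LocalStep : Finset Vr → Finset Cs → St → List St → Prop
  | null (i : ℕ) (P : Finset Tm) : LocalStep ∅ ∅ ⟨i, P, Tm.top⟩ []
  | backchain (i : ℕ) (P : Finset Tm) (g : Tm)
      (xs : List (ℕ × Ty)) (G Ar : Tm) (ws : List Vr) (θ : Subst) :
      g.isAtom → g.rigid →
      Tm.alls xs (Tm.impl G Ar) ∈ elabProg P →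
      List.Forall₂ (fun (w : Vr) (x : ℕ × Ty) => w.ty = x.2 ∧ w.lvl ≤ i) ws xs →
      ws.Nodup →
      θ.legal → θ.safe → (∀ v : Vr, θ.f v ≠ Tm.fvar v → v ∈ ws) →
      Tm.subst θ.f g = Tm.subst θ.f (Tm.instL xs (ws.map Tm.fvar) Ar) →
      LocalStep ws.toFinset ∅ ⟨i, P, g⟩
        [⟨i, P, Tm.subst θ.f (Tm.instL xs (ws.map Tm.fvar) G)⟩]
  | ax (i : ℕ) (P : Finset Tm) (g : Tm)
      (xs : List (ℕ × Ty)) (Ar : Tm) (ws : List Vr) (θ : Subst) :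
      g.isAtom → g.rigid → Ar.isAtom →
      Tm.alls xs Ar ∈ elabProg P →
      List.Forall₂ (fun (w : Vr) (x : ℕ × Ty) => w.ty = x.2 ∧ w.lvl ≤ i) ws xs →
      ws.Nodup →
      θ.legal → θ.safe → (∀ v : Vr, θ.f v ≠ Tm.fvar v → v ∈ ws) →
      Tm.subst θ.f g = Tm.subst θ.f (Tm.instL xs (ws.map Tm.fvar) Ar) →
      LocalStep ws.toFinset ∅ ⟨i, P, g⟩ []
  | orl (i : ℕ) (P : Finset Tm) (g₁ g₂ : Tm) :
      LocalStep ∅ ∅ ⟨i, P, Tm.disj g₁ g₂⟩ [⟨i, P, g₁⟩]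
  | orr (i : ℕ) (P : Finset Tm) (g₁ g₂ : Tm) :
      LocalStep ∅ ∅ ⟨i, P, Tm.disj g₁ g₂⟩ [⟨i, P, g₂⟩]
  | and (i : ℕ) (P : Finset Tm) (g₁ g₂ : Tm) :
      LocalStep ∅ ∅ ⟨i, P, Tm.conj g₁ g₂⟩ [⟨i, P, g₁⟩, ⟨i, P, g₂⟩]
  | inst (i : ℕ) (P : Finset Tm) (x : ℕ) (a : Ty) (g t : Tm) :
      t.pos → t.wt → t.tyOf = a → t.lvl ≤ i →
      LocalStep ∅ ∅ ⟨i, P, Tm.ex x a g⟩ [⟨i, P, Tm.inst x a t g⟩]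
  | augment (i : ℕ) (P : Finset Tm) (d g : Tm) :
      LocalStep ∅ ∅ ⟨i, P, Tm.impl d g⟩ [⟨i, insert d P, g⟩]
  | generic (i : ℕ) (P : Finset Tm) (x : ℕ) (a : Ty) (g : Tm) (c : Cs) :
      c.lvl = i + 1 → c.ty = a →
      LocalStep ∅ {c} ⟨i, P, Tm.all x a g⟩ [⟨i + 1, P, Tm.inst x a (Tm.cst c) g⟩]

theorem subst_fixes_of_fresh {θ : Subst} {ws : List Vr} {S : Finset Vr}
    (hdom : ∀ v : Vr, θ.f v ≠ Tm.fvar v → v ∈ ws) (hfr : ∀ w ∈ ws, w ∉ S) :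
    ∀ v ∈ S, θ.f v = Tm.fvar v := by
  intro v hv
  by_contra h
  exact hfr v (hdom v h) hv

theorem svFvars_subset_of_subset {A B : List St} (h : A ⊆ B) : svFvars A ⊆ svFvars B := by
  intro v hv
  obtain ⟨s, hs, hv⟩ := mem_svFvars.1 hv
  exact mem_svFvars.2 ⟨s, h hs, hv⟩

theorem svSub_split_eq {θ : Subst} {L R : List St} {s : St}
    (h : ∀ v ∈ svFvars (L ++ s :: R), θ.f v = Tm.fvar v) :
    svSub θ L = L ∧ s.prog.image (Tm.subst θ.f) = s.prog ∧ svSub θ R = R :=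
  ⟨svSub_eq_self fun v hv => h v (svFvars_subset_of_subset (by simp) hv),
    St.image_subst_eq_self fun v hv => h v (mem_svFvars.2 ⟨s, by simp, hv⟩),
    svSub_eq_self fun v hv => h v (svFvars_subset_of_subset (by intro x hx; simp [hx]) hv)⟩

theorem FlatStep.exists_localStep {A B : List St} {σ : Subst} (h : FlatStep A σ B) :
    ∃ L s R C W K, A = L ++ s :: R ∧ B = L ++ C ++ R ∧ LocalStep W K s C ∧
      (∀ w ∈ W, w ∉ svFvars A) ∧ ∀ c ∈ K, c ∉ svCsts A := by
  cases h with
  | null L R i P => exact ⟨L, _, R, _, _, _, rfl, by simp, .null i P, by simp, by simp⟩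
  | backchain L R i P g xs G Ar ws θ h₁ h₂ h₃ h₄ h₅ h₆ h₇ h₈ h₉ h₁₀ =>
    obtain ⟨e₁, e₂, e₃⟩ := svSub_split_eq (subst_fixes_of_fresh h₉ h₆)
    refine ⟨L, _, R, _, _, _, rfl, ?_,
      .backchain i P g xs G Ar ws σ h₁ h₂ h₃ h₄ h₅ h₇ h₈ h₉ h₁₀, by simpa using h₆, by simp⟩
    simp only at e₂
    simp [e₁, e₂, e₃]
  | ax L R i P g xs Ar ws θ h₁ h₂ h₀ h₃ h₄ h₅ h₆ h₇ h₈ h₉ h₁₀ =>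
    obtain ⟨e₁, e₂, e₃⟩ := svSub_split_eq (subst_fixes_of_fresh h₉ h₆)
    refine ⟨L, _, R, _, _, _, rfl, ?_,
      .ax i P g xs Ar ws σ h₁ h₂ h₀ h₃ h₄ h₅ h₇ h₈ h₉ h₁₀, by simpa using h₆, by simp⟩
    simp [e₁, e₃]
  | orl L R i P g₁ g₂ =>
    exact ⟨L, _, R, _, _, _, rfl, by simp, .orl i P g₁ g₂, by simp, by simp⟩
  | orr L R i P g₁ g₂ =>
    exact ⟨L, _, R, _, _, _, rfl, by simp, .orr i P g₁ g₂, by simp, by simp⟩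
  | and L R i P g₁ g₂ =>
    exact ⟨L, _, R, _, _, _, rfl, by simp, .and i P g₁ g₂, by simp, by simp⟩
  | inst L R i P x a g t h₁ h₂ h₃ h₄ =>
    exact ⟨L, _, R, _, _, _, rfl, by simp, .inst i P x a g t h₁ h₂ h₃ h₄, by simp, by simp⟩
  | augment L R i P d g =>
    exact ⟨L, _, R, _, _, _, rfl, by simp, .augment i P d g, by simp, by simp⟩
  | generic L R i P x a g c h₁ h₂ h₃ =>
    exact ⟨L, _, R, _, _, _, rfl, by simp, .generic i P x a g c h₁ h₂, by simp, by simpa using h₃⟩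

namespace LocalStep

theorem exists_flatStep {W : Finset Vr} {K : Finset Cs} {s : St} {C : List St}
    (h : LocalStep W K s C) (L R : List St) (hW : ∀ w ∈ W, w ∉ svFvars (L ++ s :: R))
    (hK : ∀ c ∈ K, c ∉ svCsts (L ++ s :: R)) :
    ∃ σ, FlatStep (L ++ s :: R) σ (L ++ C ++ R) := by
  cases h with
  | null i P => exact ⟨_, by simpa using FlatStep.null L R i P⟩
  | backchain i P g xs G Ar ws θ h₁ h₂ h₃ h₄ h₅ h₇ h₈ h₉ h₁₀ =>
    replace hW : ∀ w ∈ ws, w ∉ svFvars (L ++ St.mk i P g :: R) := by simpa using hW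
    obtain ⟨e₁, e₂, e₃⟩ := svSub_split_eq (subst_fixes_of_fresh h₉ hW)
    have := FlatStep.backchain L R i P g xs G Ar ws θ h₁ h₂ h₃ h₄ h₅ hW h₇ h₈ h₉ h₁₀
    simp only at e₂
    rw [e₁, e₂, e₃] at this
    exact ⟨θ, by simpa using this⟩
  | ax i P g xs Ar ws θ h₁ h₂ h₀ h₃ h₄ h₅ h₇ h₈ h₉ h₁₀ =>
    replace hW : ∀ w ∈ ws, w ∉ svFvars (L ++ St.mk i P g :: R) := by simpa using hW
    obtain ⟨e₁, e₂, e₃⟩ := svSub_split_eq (subst_fixes_of_fresh h₉ hW)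
    have := FlatStep.ax L R i P g xs Ar ws θ h₁ h₂ h₀ h₃ h₄ h₅ hW h₇ h₈ h₉ h₁₀
    rw [e₁, e₃] at this
    exact ⟨θ, by simpa using this⟩
  | orl i P g₁ g₂ => exact ⟨_, by simpa using FlatStep.orl L R i P g₁ g₂⟩
  | orr i P g₁ g₂ => exact ⟨_, by simpa using FlatStep.orr L R i P g₁ g₂⟩
  | and i P g₁ g₂ => exact ⟨_, by simpa using FlatStep.and L R i P g₁ g₂⟩
  | inst i P x a g t h₁ h₂ h₃ h₄ =>
    exact ⟨_, by simpa using FlatStep.inst L R i P x a g t h₁ h₂ h₃ h₄⟩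
  | augment i P d g => exact ⟨_, by simpa using FlatStep.augment L R i P d g⟩
  | generic i P x a g c h₁ h₂ =>
    exact ⟨_, by simpa using FlatStep.generic L R i P x a g c h₁ h₂ (hK c (by simp))⟩

theorem ren {W : Finset Vr} {K : Finset Cs} {s : St} {C : List St}
    (h : LocalStep W K s C) (r : Renaming) :
    LocalStep (W.image r.v) (K.image r.c) (s.ren r) (C.map (St.ren r)) := by
  have fresh_map : ∀ {i : ℕ} {ws : List Vr} {xs : List (ℕ × Ty)},
      List.Forall₂ (fun (w : Vr) (x : ℕ × Ty) => w.ty = x.2 ∧ w.lvl ≤ i) ws xs →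
      List.Forall₂ (fun (w : Vr) (x : ℕ × Ty) => w.ty = x.2 ∧ w.lvl ≤ i) (ws.map r.v) xs := by
    intro i ws xs h
    simpa [List.forall₂_map_left_iff, r.v_ty, r.v_lvl] using h
  have dom_map : ∀ {θ : Subst} {ws : List Vr}, (∀ v : Vr, θ.f v ≠ Tm.fvar v → v ∈ ws) →
      ∀ v : Vr, (θ.ren r).f v ≠ Tm.fvar v → v ∈ ws.map r.v := by
    intro θ ws h v hv
    exact List.mem_map.2 ⟨_, h _ (Subst.ren_f_ne hv), by simp⟩
  have instL_map : ∀ (xs : List (ℕ × Ty)) (ws : List Vr) (t : Tm),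
      (Tm.instL xs (ws.map Tm.fvar) t).ren r =
        Tm.instL xs ((ws.map r.v).map Tm.fvar) (t.ren r) := by
    intro xs ws t
    rw [Tm.instL_ren, List.map_map, List.map_map]
    rfl
  have toFinset_map : ∀ ws : List Vr, ws.toFinset.image r.v = (ws.map r.v).toFinset := by
    intro ws
    ext v
    simp
  cases h with
  | null i P => exact .null i _
  | backchain i P g xs G Ar ws θ h₁ h₂ h₃ h₄ h₅ h₇ h₈ h₉ h₁₀ =>
    have := LocalStep.backchain i (P.image (Tm.ren r)) (g.ren r) xs (G.ren r) (Ar.ren r)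
      (ws.map r.v) (θ.ren r) ((Tm.isAtom_ren r g).2 h₁) (h₂.ren r)
      (by simpa [Tm.alls_ren, Tm.ren] using ren_mem_elabProg r h₃) (fresh_map h₄)
      (h₅.map r.v.injective) (h₇.ren r) (h₈.ren r) (dom_map h₉)
      (by rw [← instL_map, Subst.subst_ren, Subst.subst_ren, h₁₀])
    rw [← instL_map, Subst.subst_ren] at this
    rw [toFinset_map]
    exact this
  | ax i P g xs Ar ws θ h₁ h₂ h₀ h₃ h₄ h₅ h₇ h₈ h₉ h₁₀ =>
    rw [toFinset_map]
    exact LocalStep.ax i (P.image (Tm.ren r)) (g.ren r) xs (Ar.ren r)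
      (ws.map r.v) (θ.ren r) ((Tm.isAtom_ren r g).2 h₁) (h₂.ren r) ((Tm.isAtom_ren r Ar).2 h₀)
      (by simpa [Tm.alls_ren] using ren_mem_elabProg r h₃) (fresh_map h₄)
      (h₅.map r.v.injective) (h₇.ren r) (h₈.ren r) (dom_map h₉)
      (by rw [← instL_map, Subst.subst_ren, Subst.subst_ren, h₁₀])
  | orl i P g₁ g₂ => exact .orl i _ _ _
  | orr i P g₁ g₂ => exact .orr i _ _ _
  | and i P g₁ g₂ => exact .and i _ _ _
  | inst i P x a g t h₁ h₂ h₃ h₄ =>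
    simp only [List.map, St.ren, Tm.inst_ren]
    exact .inst i _ x a _ _ ((Tm.pos_ren r t).2 h₁) ((Tm.wt_ren r t).2 h₂)
      ((Tm.tyOf_ren r t).trans h₃) ((Tm.lvl_ren r t).trans_le h₄)
  | augment i P d g =>
    simp only [List.map, St.ren, Finset.image_insert]
    exact .augment i _ _ _
  | generic i P x a g c h₁ h₂ =>
    simp only [List.map, St.ren, Tm.inst_ren, Finset.image_singleton]
    exact .generic i _ x a _ _ ((r.c_lvl c).trans h₁) ((r.c_ty c).trans h₂)

theorem weaken {W : Finset Vr} {K : Finset Cs} {s s' : St} {C : List St}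
    (h : LocalStep W K s C) (hs : s.Weaker s') :
    ∃ C', LocalStep W K s' C' ∧ List.Forall₂ St.Weaker C C' := by
  obtain ⟨i', P', g'⟩ := s'
  cases h <;> obtain ⟨rfl, hP, rfl⟩ := hs
  case null i P => exact ⟨_, .null _ P', .nil⟩
  case backchain i P g xs G Ar ws θ h₁ h₂ h₃ h₄ h₅ h₇ h₈ h₉ h₁₀ =>
    exact ⟨_, .backchain _ P' _ xs G Ar ws θ h₁ h₂ (hP h₃) h₄ h₅ h₇ h₈ h₉ h₁₀,
      .cons ⟨rfl, hP, rfl⟩ .nil⟩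
  case ax i P g xs Ar ws θ h₁ h₂ h₀ h₃ h₄ h₅ h₇ h₈ h₉ h₁₀ =>
    exact ⟨_, .ax _ P' _ xs Ar ws θ h₁ h₂ h₀ (hP h₃) h₄ h₅ h₇ h₈ h₉ h₁₀, .nil⟩
  case orl i P g₁ g₂ => exact ⟨_, .orl _ P' g₁ g₂, .cons ⟨rfl, hP, rfl⟩ .nil⟩
  case orr i P g₁ g₂ => exact ⟨_, .orr _ P' g₁ g₂, .cons ⟨rfl, hP, rfl⟩ .nil⟩
  case and i P g₁ g₂ =>
    exact ⟨_, .and _ P' g₁ g₂, .cons ⟨rfl, hP, rfl⟩ (.cons ⟨rfl, hP, rfl⟩ .nil)⟩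
  case inst i P x a g t h₁ h₂ h₃ h₄ =>
    exact ⟨_, .inst _ P' x a g t h₁ h₂ h₃ h₄, .cons ⟨rfl, hP, rfl⟩ .nil⟩
  case augment i P d g =>
    refine ⟨_, .augment _ P' d g, .cons ⟨rfl, ?_, rfl⟩ .nil⟩
    simp only [elabProg, Finset.set_biUnion_insert]
    exact Set.union_subset_union_right _ hP
  case generic i P x a g c h₁ h₂ =>
    exact ⟨_, .generic _ P' x a g c h₁ h₂, .cons ⟨rfl, hP, rfl⟩ .nil⟩

end LocalStep

theorem FlatStep.ren {A B : List St} {σ : Subst} (h : FlatStep A σ B) (r : Renaming) :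
    ∃ τ, FlatStep (A.map (St.ren r)) τ (B.map (St.ren r)) := by
  obtain ⟨L, s, R, C, W, K, rfl, rfl, hC, hW, hK⟩ := h.exists_localStep
  have := (hC.ren r).exists_flatStep (L.map (St.ren r)) (R.map (St.ren r)) ?_ ?_
  · simpa using this
  · have e : L.map (St.ren r) ++ s.ren r :: R.map (St.ren r) = (L ++ s :: R).map (St.ren r) := by
      simp
    rw [e, svFvars_map_ren]
    simpa using hW
  · have e : L.map (St.ren r) ++ s.ren r :: R.map (St.ren r) = (L ++ s :: R).map (St.ren r) := by
      simp
    rw [e, svCsts_map_ren]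
    simpa using hK

theorem FlatDeriv.ren {A B : List St} {n : ℕ} (h : FlatDeriv A B n) (r : Renaming) :
    FlatDeriv (A.map (St.ren r)) (B.map (St.ren r)) n := by
  induction h with
  | refl A => exact .refl _
  | step hs _ ih =>
    obtain ⟨τ, hτ⟩ := hs.ren r
    exact .step hτ ih

/-- A finite set can be moved off another one by a permutation that respects
the fibres of a map, provided these fibres are infinite. -/
theorem exists_perm_moving_off {α β : Type*} [DecidableEq α] (key : α → β)
    (hkey : ∀ a, {x | key x = key a}.Infinite) (W X : Finset α) :
    ∃ π : Equiv.Perm α, (∀ a, key (π a) = key a) ∧ (∀ a ∈ X, a ∉ W → π a = a) ∧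
      ∀ w ∈ W, π w ∉ X := by
  induction W using Finset.induction_on generalizing X with
  | empty => exact ⟨1, by simp, by simp, by simp⟩
  | insert w W hw ih =>
    obtain ⟨π, h₁, h₂, h₃⟩ := ih (insert w X)
    obtain ⟨w', hw', hfr⟩ := (hkey w).exists_notMem_finset (X ∪ (insert w W).image π)
    simp only [Finset.mem_union, Finset.mem_image, not_or, not_exists, not_and] at hfr
    have hπw : π w = w := h₂ w (Finset.mem_insert_self _ _) hw
    refine ⟨π.trans (Equiv.swap w w'), fun a => ?_, fun a ha haW => ?_, fun a ha => ?_⟩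
    · rw [← h₁ a, Equiv.trans_apply, Equiv.swap_apply_def]
      split_ifs with e₁ e₂
      · rw [e₁]; exact hw'
      · rw [e₂]; exact hw'.symm
      · rfl
    · rw [Finset.mem_insert, not_or] at haW
      rw [Equiv.trans_apply, h₂ a (Finset.mem_insert_of_mem ha) haW.2]
      exact Equiv.swap_apply_of_ne_of_ne haW.1 fun e => hfr.1 (e ▸ ha)
    · rcases Finset.mem_insert.1 ha with rfl | haW
      · rw [Equiv.trans_apply, hπw, Equiv.swap_apply_left]
        exact hfr.1
      · have := h₃ a haW
        rw [Finset.mem_insert, not_or] at this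
        rw [Equiv.trans_apply, Equiv.swap_apply_of_ne_of_ne this.1 (hfr.2 a ha)]
        exact this.2

/-- Variables and constants that do not occur in `S` and `T` can be renamed
away from any finite sets, keeping `S` and `T` fixed. -/
theorem exists_renaming_moving_off (W S X : Finset Vr) (K T Y : Finset Cs)
    (hW : ∀ w ∈ W, w ∉ S) (hK : ∀ c ∈ K, c ∉ T) :
    ∃ r : Renaming, (∀ v ∈ S, r.v v = v) ∧ (∀ c ∈ T, r.c c = c) ∧
      (∀ w ∈ W, r.v w ∉ X) ∧ ∀ c ∈ K, r.c c ∉ Y := by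
  obtain ⟨π, h₁, h₂, h₃⟩ := exists_perm_moving_off (fun v : Vr => (v.lvl, v.ty))
    (fun a => Set.infinite_of_injective_forall_mem (f := fun n : ℕ => Vr.mk n a.lvl a.ty)
      (fun m n h => by simpa using h) (by simp)) W (S ∪ X)
  obtain ⟨ρ, k₁, k₂, k₃⟩ := exists_perm_moving_off (fun c : Cs => (c.lvl, c.ty))
    (fun a => Set.infinite_of_injective_forall_mem (f := fun n : ℕ => Cs.mk n a.lvl a.ty)
      (fun m n h => by simpa using h) (by simp)) K (T ∪ Y)
  simp only [Prod.mk.injEq] at h₁ k₁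
  exact ⟨⟨π, ρ, fun v => (h₁ v).1, fun v => (h₁ v).2, fun c => (k₁ c).1, fun c => (k₁ c).2⟩,
    fun v hv => h₂ v (Finset.mem_union_left _ hv) fun h => hW v h hv,
    fun c hc => k₂ c (Finset.mem_union_left _ hc) fun h => hK c h hc,
    fun w hw h => h₃ w hw (Finset.mem_union_right _ h),
    fun c hc h => k₃ c hc (Finset.mem_union_right _ h)⟩

theorem FlatDeriv.weaken {n : ℕ} {A A' : List St} (h : FlatDeriv A [] n)
    (hA : List.Forall₂ St.Weaker A A') : FlatDeriv A' [] n := by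
  induction n generalizing A A' with
  | zero =>
    cases h
    cases hA
    exact .refl _
  | succ n ih =>
    obtain _ | ⟨hs, hd⟩ := h
    obtain ⟨L, s, R, C, W, K, rfl, rfl, hC, hW, hK⟩ := hs.exists_localStep
    obtain ⟨r, hrv, hrc, hrW, hrK⟩ := exists_renaming_moving_off W _ (svFvars A') K _
      (svCsts A') hW hK
    have hfix := map_ren_eq_self hrv hrc
    simp only [List.map_append, List.map_cons] at hfix
    obtain ⟨hL, hsR⟩ := List.append_inj hfix (by simp)
    obtain ⟨hs', hR⟩ := List.cons.inj hsR
    have hd' := hd.ren r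
    simp only [List.map_append, hL, hR, List.map_nil] at hd'
    have hC' := hC.ren r
    rw [hs'] at hC'
    have hLL := List.forall₂_take L.length hA
    have hA' := List.forall₂_drop L.length hA
    rw [List.take_left] at hLL
    rw [List.drop_left] at hA'
    rw [← List.take_append_drop L.length A'] at hrW hrK ⊢
    generalize A'.take L.length = L' at *
    generalize A'.drop L.length = A'' at *
    obtain _ | ⟨hss, hRR⟩ := hA'
    obtain ⟨C', hstep, hCC⟩ := hC'.weaken hss
    obtain ⟨τ, hτ⟩ := hstep.exists_flatStep _ _ (by simpa using hrW) (by simpa using hrK)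
    exact .step hτ (ih hd' (List.rel_append (List.rel_append hLL hCC) hRR))

/-- **Left weakening for resolution.**  Let
`d : 𝔄₁ ⊗ ⟨i;P;G⟩ ⊗ 𝔄₂ ⇝^{[id]} □` be a flat successful derivation.  Then
for each program `P'` of level `≤ i` such that `elab(P') ⊇ elab(P)`, there is
a flat successful derivation `𝔄₁ ⊗ ⟨i;P';G⟩ ⊗ 𝔄₂ ⇝^{[id]} □`. -/
theorem left_weakening (A₁ A₂ : List St) (i : ℕ) (P P' : Finset Tm) (G : Tm)
    (n : ℕ)
    (hwf : svWf (A₁ ++ St.mk i P G :: A₂))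
    (hP' : ∀ D ∈ P', Tm.isProg D ∧ D.wt ∧ D.tyOf = Ty.o ∧ D.lvl ≤ i)
    (hsub : elabProg P ⊆ elabProg P')
    (h : FlatDeriv (A₁ ++ St.mk i P G :: A₂) [] n) :
    ∃ m, FlatDeriv (A₁ ++ St.mk i P' G :: A₂) [] m := by
  refine ⟨n, h.weaken ?_⟩
  have refl : ∀ A : List St, List.Forall₂ St.Weaker A A :=
    fun A => List.forall₂_same.2 fun s _ => St.Weaker.refl s
  exact List.rel_append (refl A₁) (.cons ⟨rfl, hsub, rfl⟩ (refl A₂))
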